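/- Let 𝒜 be a hyperplane arrangement in ℝⁿ with a linear order ≺ on its hyperplanes. Then the number of regions of 𝒜 equals the number of affine NBC subsets of 𝒜; that is, |ℛ(𝒜)| = |NBC(𝒜)|. -/

import Mathlib

open Set

/-- An affine hyperplane in `ℝⁿ`, given by a nonzero normal vector `a` and
a constant `b`: the hyperplane is `{x : ⟨a, x⟩ = b}`. -/
structure Hyp (n : ℕ) where
  a : Fin n → ℝ
  b : ℝ
  ha : a ≠ 0

/-- The hyperplane itself, as a subset of `ℝⁿ`. -/
def Hyp.carrier {n : ℕ} (H : Hyp n) : Set (Fin n → ℝ) := {x | ∑ i, H.a i * x i = H.b}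

/-- The positive open side of a hyperplane. -/
def Hyp.pos {n : ℕ} (H : Hyp n) : Set (Fin n → ℝ) := {x | H.b < ∑ i, H.a i * x i}

/-- The negative open side of a hyperplane. -/
def Hyp.neg {n : ℕ} (H : Hyp n) : Set (Fin n → ℝ) := {x | ∑ i, H.a i * x i < H.b}

/-- The intersection `⋂ℬ` of the hyperplanes indexed by `S` (`ℝⁿ` if `S = ∅`). -/
def interA {n m : ℕ} (H : Fin m → Hyp n) (S : Finset (Fin m)) : Set (Fin n → ℝ) :=
  ⋂ i ∈ S, (H i).carrier

/-- The dimension of an affine subset of `ℝⁿ` (the rank of its vector span). -/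
noncomputable def adim {n : ℕ} (s : Set (Fin n → ℝ)) : ℕ :=
  Module.finrank ℝ (vectorSpan ℝ s)

/-- The defining property of an affine circuit: `⋂ℬ ≠ ∅` and `dim(⋂ℬ) + |ℬ| = n + 1`. -/
def CircuitProp {n m : ℕ} (H : Fin m → Hyp n) (S : Finset (Fin m)) : Prop :=
  (interA H S).Nonempty ∧ adim (interA H S) + S.card = n + 1

/-- An affine circuit: an inclusion-minimal `S` with `⋂S ≠ ∅` and `dim(⋂S) + |S| = n + 1`. -/
def IsAffCircuit {n m : ℕ} (H : Fin m → Hyp n) (S : Finset (Fin m)) : Prop :=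
  CircuitProp H S ∧ ∀ T ⊂ S, ¬ CircuitProp H T

/-- An affine NBC subset: `⋂S ≠ ∅` and `S` contains no affine broken circuit, i.e. no
affine circuit with its maximal element deleted. -/
def IsAffNBC {n m : ℕ} (H : Fin m → Hyp n) (S : Finset (Fin m)) : Prop :=
  (interA H S).Nonempty ∧
    ∀ T : Finset (Fin m), IsAffCircuit H T → ∀ h : T.Nonempty, ¬ T.erase (T.max' h) ⊆ S

/-- `Δ` is a region of the open set `U`, i.e. a connected component of `U`. -/
def IsRegionIn {n : ℕ} (U Δ : Set (Fin n → ℝ)) : Prop :=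
  ∃ x ∈ U, Δ = connectedComponentIn U x

/-- The set of regions of the arrangement `H`: connected components of the complement
of the union of the hyperplanes. -/
def regions {n m : ℕ} (H : Fin m → Hyp n) : Set (Set (Fin n → ℝ)) :=
  {Δ | IsRegionIn (Set.univ \ ⋃ i, (H i).carrier) Δ}

/-- The sign `±1` encoded by a Boolean. -/
def boolSign (b : Bool) : ℝ := if b then 1 else -1

/-- The points at which the affine functions `f i` have the nonzero signs prescribed by `σ`. -/
def signCell {n m : ℕ} (f : Fin m → (Fin n → ℝ) →ᵃ[ℝ] ℝ) (σ : Fin m → Bool) :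
    Set (Fin n → ℝ) :=
  {x | ∀ i, 0 < boolSign (σ i) * f i x}

/-- The nowhere vanishing sign vectors realized by the family `f` on `W`. -/
def signVectors {n m : ℕ} (W : Set (Fin n → ℝ)) (f : Fin m → (Fin n → ℝ) →ᵃ[ℝ] ℝ) :
    Set (Fin m → Bool) :=
  {σ | (W ∩ signCell f σ).Nonempty}

/-- Indicator vectors of the sets `S` whose common zero locus in `W` is nonempty and such that no
`f j` vanishes on the common zero locus in `W` of the elements of `S` preceding `j`. -/
def nbcVectors {n m : ℕ} (W : Set (Fin n → ℝ)) (f : Fin m → (Fin n → ℝ) →ᵃ[ℝ] ℝ) :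
    Set (Fin m → Bool) :=
  {σ | (∃ x ∈ W, ∀ i, σ i = true → f i x = 0) ∧
    ∀ j, ∃ x ∈ W, (∀ i, i < j → σ i = true → f i x = 0) ∧ f j x ≠ 0}

theorem ncard_fin_succ_bool {m : ℕ} (A : Set (Fin (m + 1) → Bool)) :
    A.ncard = {τ : Fin m → Bool | Fin.cons true τ ∈ A}.ncard +
      {τ : Fin m → Bool | Fin.cons false τ ∈ A}.ncard := by
  have hA : A = (fun τ : Fin m → Bool => (Fin.cons true τ : Fin (m + 1) → Bool)) ''
        {τ | Fin.cons true τ ∈ A} ∪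
      (fun τ : Fin m → Bool => (Fin.cons false τ : Fin (m + 1) → Bool)) ''
        {τ | Fin.cons false τ ∈ A} := by
    ext σ
    constructor
    · intro h
      have hσ : (Fin.cons (σ 0) (Fin.tail σ) : Fin (m + 1) → Bool) = σ := Fin.cons_self_tail σ
      cases h0 : σ 0
      · right
        rw [h0] at hσ
        exact ⟨Fin.tail σ, by simpa only [mem_ofPred_eq, hσ] using h, hσ⟩
      · left
        rw [h0] at hσ
        exact ⟨Fin.tail σ, by simpa only [mem_ofPred_eq, hσ] using h, hσ⟩
    · rintro (⟨τ, h, rfl⟩ | ⟨τ, h, rfl⟩) <;> exact h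
  conv_lhs => rw [hA]
  have hinj (b : Bool) : Function.Injective fun τ : Fin m → Bool =>
      (Fin.cons b τ : Fin (m + 1) → Bool) :=
    Fin.cons_right_injective (α := fun _ => Bool) b
  rw [ncard_union_eq, ncard_image_of_injective _ (hinj true),
    ncard_image_of_injective _ (hinj false)]
  rw [Set.disjoint_left]
  rintro _ ⟨τ, -, rfl⟩ ⟨τ', -, h⟩
  simpa using congrFun h 0

theorem lineMap_mem_signCell {n m : ℕ} {f : Fin m → (Fin n → ℝ) →ᵃ[ℝ] ℝ} {σ : Fin m → Bool}
    {x : Fin n → ℝ} (hx : x ∈ signCell f σ) (y : Fin n → ℝ) :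
    ∃ δ > 0, ∀ t : ℝ, |t| < δ → AffineMap.lineMap x y t ∈ signCell f σ := by
  have h : ∀ᶠ t : ℝ in nhds 0, ∀ i, 0 < boolSign (σ i) * f i (AffineMap.lineMap x y t) := by
    refine Filter.eventually_all.2 fun i => ?_
    have hc : Continuous fun t : ℝ => boolSign (σ i) * f i (AffineMap.lineMap x y t) := by
      simp only [AffineMap.apply_lineMap, AffineMap.lineMap_apply_ring']
      fun_prop
    refine hc.continuousAt.eventually_const_lt ?_
    simpa using hx i
  obtain ⟨δ, hδ, h⟩ := Metric.eventually_nhds_iff.1 h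
  exact ⟨δ, hδ, fun t ht => h (by simpa using ht)⟩

theorem convex_signCell {n m : ℕ} (f : Fin m → (Fin n → ℝ) →ᵃ[ℝ] ℝ) (σ : Fin m → Bool) :
    Convex ℝ (signCell f σ) := by
  have h : signCell f σ = ⋂ i, (f i) ⁻¹' {r | 0 < boolSign (σ i) * r} := by
    ext x
    simp [signCell]
  rw [h]
  refine convex_iInter fun i => Convex.affine_preimage (f i) ?_
  exact (convex_Ioi (0 : ℝ)).is_linear_preimage (IsLinearMap.isLinearMap_smul (boolSign (σ i)))

theorem mem_signCell_cons {n m : ℕ} (f : Fin (m + 1) → (Fin n → ℝ) →ᵃ[ℝ] ℝ) (b : Bool)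
    (τ : Fin m → Bool) (x : Fin n → ℝ) :
    x ∈ signCell f (Fin.cons b τ) ↔
      0 < boolSign b * f 0 x ∧ x ∈ signCell (fun i => f i.succ) τ := by
  simp [signCell, Fin.forall_fin_succ]

theorem cons_mem_signVectors_of_apply_eq_zero {n m : ℕ} {W : Set (Fin n → ℝ)}
    (hW : ∀ x ∈ W, ∀ y ∈ W, ∀ t : ℝ, AffineMap.lineMap x y t ∈ W)
    (f : Fin (m + 1) → (Fin n → ℝ) →ᵃ[ℝ] ℝ) {x y : Fin n → ℝ} (hx : x ∈ W) (hy : y ∈ W)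
    (hx0 : f 0 x = 0) (hy0 : f 0 y ≠ 0) {τ : Fin m → Bool}
    (hxτ : x ∈ signCell (fun i => f i.succ) τ) (b : Bool) :
    Fin.cons b τ ∈ signVectors W f := by
  obtain ⟨δ, hδ, h⟩ := lineMap_mem_signCell hxτ y
  obtain ⟨t, ht, htp⟩ : ∃ t : ℝ, |t| < δ ∧ 0 < boolSign b * (t * f 0 y) := by
    have h2 : |δ / 2| < δ := by rw [abs_of_pos (by positivity)]; linarith
    have h2' : |-(δ / 2)| < δ := by rwa [abs_neg]
    rcases lt_or_gt_of_ne hy0 with h0 | h0 <;> cases b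
    · exact ⟨δ / 2, h2, by simp only [boolSign]; norm_num; nlinarith⟩
    · exact ⟨-(δ / 2), h2', by simp only [boolSign]; norm_num; nlinarith⟩
    · exact ⟨-(δ / 2), h2', by simp only [boolSign]; norm_num; nlinarith⟩
    · exact ⟨δ / 2, h2, by simp only [boolSign]; norm_num; nlinarith⟩
  refine ⟨AffineMap.lineMap x y t, hW x hx y hy t, (mem_signCell_cons _ _ _ _).2 ⟨?_, h t ht⟩⟩
  rw [AffineMap.apply_lineMap, AffineMap.lineMap_apply_ring', hx0]
  simpa using htp

theorem ncard_signVectors_succ {n m : ℕ} {W : Set (Fin n → ℝ)}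
    (hW : ∀ x ∈ W, ∀ y ∈ W, ∀ t : ℝ, AffineMap.lineMap x y t ∈ W)
    (f : Fin (m + 1) → (Fin n → ℝ) →ᵃ[ℝ] ℝ) (h0 : ∃ y ∈ W, f 0 y ≠ 0) :
    (signVectors W f).ncard = (signVectors W fun i => f i.succ).ncard +
      (signVectors (W ∩ {x | f 0 x = 0}) fun i => f i.succ).ncard := by
  obtain ⟨y, hy, hy0⟩ := h0
  rw [ncard_fin_succ_bool, ← ncard_union_add_ncard_inter]
  congr 2
  · ext τ
    constructor
    · rintro (⟨x, hx, h⟩ | ⟨x, hx, h⟩) <;>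
        exact ⟨x, hx, ((mem_signCell_cons _ _ _ _).1 h).2⟩
    · rintro ⟨x, hx, h⟩
      rcases lt_trichotomy (f 0 x) 0 with hlt | heq | hgt
      · exact Or.inr ⟨x, hx, (mem_signCell_cons _ _ _ _).2 ⟨by simpa [boolSign] using hlt, h⟩⟩
      · exact Or.inl (cons_mem_signVectors_of_apply_eq_zero hW f hx hy heq hy0 h true)
      · exact Or.inl ⟨x, hx, (mem_signCell_cons _ _ _ _).2 ⟨by simpa [boolSign] using hgt, h⟩⟩
  · ext τ
    constructor
    · rintro ⟨⟨x, hx, h⟩, ⟨z, hz, h'⟩⟩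
      rw [mem_signCell_cons] at h h'
      have hxp : 0 < f 0 x := by simpa [boolSign] using h.1
      have hzp : f 0 z < 0 := by simpa [boolSign] using h'.1
      have hd : 0 < f 0 x - f 0 z := by linarith
      refine ⟨AffineMap.lineMap x z (f 0 x / (f 0 x - f 0 z)), ⟨hW x hx z hz _, ?_⟩, ?_⟩
      · rw [mem_ofPred_eq, AffineMap.apply_lineMap, AffineMap.lineMap_apply_ring']
        field_simp
        ring
      · refine (convex_signCell _ τ).lineMap_mem h.2 h'.2 ⟨by positivity, ?_⟩
        rw [div_le_one hd]
        linarith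
    · rintro ⟨x, ⟨hx, hx0⟩, h⟩
      exact ⟨cons_mem_signVectors_of_apply_eq_zero hW f hx hy hx0 hy0 h true,
        cons_mem_signVectors_of_apply_eq_zero hW f hx hy hx0 hy0 h false⟩

theorem ncard_nbcVectors_succ {n m : ℕ} {W : Set (Fin n → ℝ)}
    (f : Fin (m + 1) → (Fin n → ℝ) →ᵃ[ℝ] ℝ) (h0 : ∃ y ∈ W, f 0 y ≠ 0) :
    (nbcVectors W f).ncard = (nbcVectors W fun i => f i.succ).ncard +
      (nbcVectors (W ∩ {x | f 0 x = 0}) fun i => f i.succ).ncard := by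
  rw [ncard_fin_succ_bool, add_comm]
  congr 2
  · ext τ
    simp [nbcVectors, Fin.forall_fin_succ, h0]
  · ext τ
    simp [nbcVectors, Fin.forall_fin_succ, h0, and_assoc]

theorem ncard_signVectors_eq_ncard_nbcVectors {n m : ℕ} {W : Set (Fin n → ℝ)}
    (hW : ∀ x ∈ W, ∀ y ∈ W, ∀ t : ℝ, AffineMap.lineMap x y t ∈ W)
    (f : Fin m → (Fin n → ℝ) →ᵃ[ℝ] ℝ) :
    (signVectors W f).ncard = (nbcVectors W f).ncard := by
  induction m generalizing W with
  | zero =>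
    congr 1
    ext σ
    simp [signVectors, nbcVectors, signCell, Set.Nonempty]
  | succ m ih =>
    by_cases h0 : ∃ y ∈ W, f 0 y ≠ 0
    · rw [ncard_signVectors_succ hW f h0, ncard_nbcVectors_succ f h0, ih hW, ih]
      rintro x ⟨hx, hx0⟩ y ⟨hy, hy0⟩ t
      refine ⟨hW x hx y hy t, ?_⟩
      rw [mem_ofPred_eq] at *
      rw [AffineMap.apply_lineMap, hx0, hy0, AffineMap.lineMap_same_apply]
    · have h1 : signVectors W f = ∅ := by
        refine eq_empty_of_forall_notMem ?_
        rintro σ ⟨x, hx, h⟩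
        refine h0 ⟨x, hx, fun h2 => ?_⟩
        simpa [h2] using h 0
      have h2 : nbcVectors W f = ∅ := by
        refine eq_empty_of_forall_notMem ?_
        rintro σ ⟨-, h⟩
        obtain ⟨x, hx, -, h⟩ := h 0
        exact h0 ⟨x, hx, h⟩
      rw [h1, h2]

/-- The linear functional `⟨α_H, ·⟩`. -/
noncomputable def Hyp.linear {n : ℕ} (H : Hyp n) : (Fin n → ℝ) →ₗ[ℝ] ℝ :=
  ∑ i, H.a i • LinearMap.proj i

/-- The affine function `⟨α_H, ·⟩ - b_H`, whose zero locus is the hyperplane. -/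
noncomputable def Hyp.affine {n : ℕ} (H : Hyp n) : (Fin n → ℝ) →ᵃ[ℝ] ℝ :=
  H.linear.toAffineMap - AffineMap.const ℝ _ H.b

theorem Hyp.linear_apply {n : ℕ} (H : Hyp n) (x : Fin n → ℝ) :
    H.linear x = ∑ i, H.a i * x i := by
  simp [Hyp.linear]

theorem Hyp.affine_apply {n : ℕ} (H : Hyp n) (x : Fin n → ℝ) :
    H.affine x = H.linear x - H.b := by
  simp [Hyp.affine]

theorem Hyp.mem_carrier {n : ℕ} (H : Hyp n) (x : Fin n → ℝ) :
    x ∈ H.carrier ↔ H.linear x = H.b := by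
  simp [Hyp.carrier, Hyp.linear_apply]

theorem Hyp.affine_eq_zero_iff {n : ℕ} (H : Hyp n) (x : Fin n → ℝ) :
    H.affine x = 0 ↔ x ∈ H.carrier := by
  rw [Hyp.affine_apply, Hyp.mem_carrier, sub_eq_zero]

theorem mem_complement_iff {n m : ℕ} (H : Fin m → Hyp n) (x : Fin n → ℝ) :
    x ∈ Set.univ \ ⋃ i, (H i).carrier ↔ ∀ i, (H i).affine x ≠ 0 := by
  simp [Hyp.affine_eq_zero_iff]

theorem signCell_subset_complement {n m : ℕ} (H : Fin m → Hyp n) (σ : Fin m → Bool) :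
    signCell (fun i => (H i).affine) σ ⊆ Set.univ \ ⋃ i, (H i).carrier := by
  intro x hx
  rw [mem_complement_iff]
  intro i h
  simpa [h] using hx i

theorem exists_mem_signCell {n m : ℕ} (f : Fin m → (Fin n → ℝ) →ᵃ[ℝ] ℝ) {x : Fin n → ℝ}
    (hx : ∀ i, f i x ≠ 0) : ∃ σ, x ∈ signCell f σ := by
  refine ⟨fun i => decide (0 < f i x), fun i => ?_⟩
  rcases lt_or_gt_of_ne (hx i) with h | h
  · simp [boolSign, h, not_lt.2 h.le]
  · simp [boolSign, h]

theorem connectedComponentIn_eq_signCell {n m : ℕ} (H : Fin m → Hyp n) {σ : Fin m → Bool}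
    {x : Fin n → ℝ} (hx : x ∈ signCell (fun i => (H i).affine) σ) :
    connectedComponentIn (Set.univ \ ⋃ i, (H i).carrier) x =
      signCell (fun i => (H i).affine) σ := by
  apply Subset.antisymm
  · intro y hy i
    by_contra hneg
    have hc : Continuous fun z => boolSign (σ i) * (H i).affine z :=
      continuous_const.mul (AffineMap.continuous_of_finiteDimensional _)
    have hxU := signCell_subset_complement H σ hx
    obtain ⟨z, hz, hz0⟩ := isPreconnected_connectedComponentIn.intermediate_value
      hy (mem_connectedComponentIn hxU) hc.continuousOn ⟨not_lt.1 hneg, (hx i).le⟩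
    have hzU := (mem_complement_iff H z).1 (connectedComponentIn_subset _ _ hz) i
    have hs : boolSign (σ i) ≠ 0 := by
      unfold boolSign
      split_ifs <;> norm_num
    exact mul_ne_zero hs hzU hz0
  · exact (convex_signCell _ σ).isPreconnected.subset_connectedComponentIn hx
      (signCell_subset_complement H σ)

theorem ncard_regions_eq_ncard_signVectors {n m : ℕ} (H : Fin m → Hyp n) :
    (regions H).ncard = (signVectors univ fun i => (H i).affine).ncard := by
  have h : regions H =
      signCell (fun i => (H i).affine) '' signVectors univ fun i => (H i).affine := by
    ext Δ
    constructor
    · rintro ⟨x, hx, rfl⟩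
      obtain ⟨σ, hσ⟩ := exists_mem_signCell (fun i => (H i).affine) ((mem_complement_iff H x).1 hx)
      exact ⟨σ, ⟨x, mem_univ x, hσ⟩, (connectedComponentIn_eq_signCell H hσ).symm⟩
    · rintro ⟨σ, ⟨x, -, hσ⟩, rfl⟩
      exact ⟨x, signCell_subset_complement H σ hσ, (connectedComponentIn_eq_signCell H hσ).symm⟩
  rw [h, InjOn.ncard_image]
  rintro σ ⟨x, -, hx⟩ τ - hστ
  have hx' : x ∈ signCell (fun i => (H i).affine) τ := hστ ▸ hx
  ext i
  have h1 := hx i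
  have h2 := hx' i
  cases hs : σ i <;> cases ht : τ i <;> simp [hs, ht, boolSign] at h1 h2 ⊢ <;> linarith

theorem mem_interA {n m : ℕ} (H : Fin m → Hyp n) (S : Finset (Fin m)) (x : Fin n → ℝ) :
    x ∈ interA H S ↔ ∀ i ∈ S, x ∈ (H i).carrier := by
  simp [interA]

theorem interA_anti {n m : ℕ} (H : Fin m → Hyp n) {S T : Finset (Fin m)} (h : S ⊆ T) :
    interA H T ⊆ interA H S := by
  intro x hx
  rw [mem_interA] at *
  exact fun i hi => hx i (h hi)

theorem adim_mono {n : ℕ} {s t : Set (Fin n → ℝ)} (h : s ⊆ t) : adim s ≤ adim t :=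
  Submodule.finrank_mono (vectorSpan_mono ℝ h)

theorem le_adim_interA_add_card {n m : ℕ} (H : Fin m → Hyp n) (S : Finset (Fin m))
    (hS : (interA H S).Nonempty) : n ≤ adim (interA H S) + S.card := by
  obtain ⟨x, hx⟩ := hS
  let φ : (Fin n → ℝ) →ₗ[ℝ] (S → ℝ) := LinearMap.pi fun i => (H i).linear
  have hker : LinearMap.ker φ ≤ vectorSpan ℝ (interA H S) := by
    intro v hv
    have hmem : v + x ∈ interA H S := by
      rw [mem_interA] at *
      intro i hi
      have hi0 : (H i).linear v = 0 := congrFun (LinearMap.mem_ker.1 hv) ⟨i, hi⟩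
      have := hx i hi
      rw [Hyp.mem_carrier] at *
      rw [map_add, hi0, this, zero_add]
    simpa using vsub_mem_vectorSpan ℝ hmem hx
  have h1 := φ.finrank_range_add_finrank_ker
  have h2 := Submodule.finrank_le (LinearMap.range φ)
  have h3 := Submodule.finrank_mono hker
  simp only [Module.finrank_fintype_fun_eq_card, Fintype.card_fin, Fintype.card_coe] at h1 h2
  unfold adim
  omega

theorem interA_subset_carrier_of_adim_le {n m : ℕ} (H : Fin m → Hyp n) {S T : Finset (Fin m)}
    (hST : S ⊆ T) (hT : (interA H T).Nonempty) (h : adim (interA H S) ≤ adim (interA H T))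
    {j : Fin m} (hj : j ∈ T) : interA H S ⊆ (H j).carrier := by
  obtain ⟨x, hx⟩ := hT
  intro y hy
  have heq : vectorSpan ℝ (interA H T) = vectorSpan ℝ (interA H S) :=
    Submodule.eq_of_le_of_finrank_le (vectorSpan_mono ℝ (interA_anti H hST)) h
  have hv : y - x ∈ vectorSpan ℝ (interA H T) := by
    rw [heq]
    exact vsub_mem_vectorSpan ℝ hy (interA_anti H hST hx)
  have hle : vectorSpan ℝ (interA H T) ≤ LinearMap.ker (H j).linear := by
    refine Submodule.span_le.2 ?_
    rintro _ ⟨p, hp, q, hq, rfl⟩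
    have h1 := (mem_interA H T p).1 hp j hj
    have h2 := (mem_interA H T q).1 hq j hj
    rw [Hyp.mem_carrier] at h1 h2
    simp [h1, h2]
  have h1 := LinearMap.mem_ker.1 (hle hv)
  have h2 := (mem_interA H T x).1 hx j hj
  rw [Hyp.mem_carrier] at *
  rw [map_sub] at h1
  linarith

theorem adim_interA_empty {n m : ℕ} (H : Fin m → Hyp n) : adim (interA H ∅) = n := by
  have h : interA H ∅ = univ := by simp [interA]
  rw [h, adim, ← AffineSubspace.top_coe ℝ (Fin n → ℝ) (Fin n → ℝ),
    ← AffineSubspace.direction_eq_vectorSpan, AffineSubspace.direction_top]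
  simp

theorem exists_subset_circuitProp {n m : ℕ} (H : Fin m → Hyp n) (S : Finset (Fin m))
    (hS : (interA H S).Nonempty) (h : n + 1 ≤ adim (interA H S) + S.card) :
    ∃ T ⊆ S, CircuitProp H T := by
  induction S using Finset.induction_on with
  | empty =>
    rw [adim_interA_empty] at h
    simp at h
  | insert i S hi ih =>
    have hsub := Finset.subset_insert i S
    by_cases hS' : n + 1 ≤ adim (interA H S) + S.card
    · obtain ⟨T, hT, hc⟩ := ih (hS.mono (interA_anti H hsub)) hS'
      exact ⟨T, hT.trans hsub, hc⟩
    · refine ⟨_, subset_rfl, hS, ?_⟩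
      have := adim_mono (interA_anti H hsub)
      rw [Finset.card_insert_of_notMem hi] at *
      omega

theorem exists_subset_isAffCircuit {n m : ℕ} (H : Fin m → Hyp n) (S : Finset (Fin m))
    (hS : CircuitProp H S) : ∃ T ⊆ S, IsAffCircuit H T := by
  induction S using Finset.strongInduction with
  | H S ih =>
    by_cases h : ∀ T ⊂ S, ¬ CircuitProp H T
    · exact ⟨S, subset_rfl, hS, h⟩
    · push Not at h
      obtain ⟨T, hT, hc⟩ := h
      obtain ⟨Q, hQ, hQc⟩ := ih T hT hc
      exact ⟨Q, hQ.trans hT.subset, hQc⟩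

theorem isAffNBC_iff {n m : ℕ} (H : Fin m → Hyp n) (S : Finset (Fin m)) :
    IsAffNBC H S ↔ (interA H S).Nonempty ∧
      ∀ j, ∃ x ∈ interA H (S.filter (· < j)), x ∉ (H j).carrier := by
  refine and_congr_right fun hS => ⟨fun h j => ?_, fun h T hT hne hsub => ?_⟩
  · by_contra! hj
    have hjS : j ∉ S.filter (· < j) := by simp
    have heq : interA H (insert j (S.filter (· < j))) = interA H (S.filter (· < j)) := by
      refine Subset.antisymm (interA_anti H (Finset.subset_insert _ _)) fun x hx => ?_
      rw [mem_interA]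
      intro i hi
      rcases Finset.mem_insert.1 hi with rfl | hi
      · exact hj x hx
      · exact (mem_interA _ _ _).1 hx i hi
    have hne := hS.mono (interA_anti H (Finset.filter_subset (· < j) S))
    have hle := le_adim_interA_add_card H _ hne
    obtain ⟨Q, hQ, hQc⟩ := exists_subset_circuitProp H (insert j (S.filter (· < j)))
      (by rwa [heq]) (by rw [heq, Finset.card_insert_of_notMem hjS]; omega)
    obtain ⟨T, hTQ, hT⟩ := exists_subset_isAffCircuit H Q hQc
    have hTne : T.Nonempty := by
      rw [Finset.nonempty_iff_ne_empty]
      rintro rfl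
      have := hT.1.2
      rw [adim_interA_empty] at this
      simp at this
    refine h T hT hTne fun i hi => ?_
    obtain ⟨himax, hiT⟩ := Finset.mem_erase.1 hi
    rcases Finset.mem_insert.1 (hQ (hTQ hiT)) with rfl | hi'
    · refine absurd (le_antisymm (T.le_max' i hiT) ?_) himax
      rcases Finset.mem_insert.1 (hQ (hTQ (T.max'_mem hTne))) with h' | h'
      · exact h'.le
      · exact (Finset.mem_filter.1 h').2.le
    · exact (Finset.mem_filter.1 hi').1
  · obtain ⟨x, hx, hxj⟩ := h (T.max' hne)
    have hmem := T.max'_mem hne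
    have hss := Finset.erase_ssubset hmem
    have hlt : ¬ n + 1 ≤ adim (interA H (T.erase (T.max' hne))) + (T.erase (T.max' hne)).card := by
      intro hle
      obtain ⟨Q, hQ, hQc⟩ := exists_subset_circuitProp H _
        (hT.1.1.mono (interA_anti H hss.subset)) hle
      exact hT.2 Q (lt_of_le_of_lt hQ hss) hQc
    have hcard := Finset.card_erase_add_one hmem
    have hdim := hT.1.2
    refine hxj (interA_subset_carrier_of_adim_le H hss.subset hT.1.1 (by omega) hmem
      (interA_anti H (fun i hi => ?_) hx))
    exact Finset.mem_filter.2 ⟨hsub hi, T.lt_max'_of_mem_erase_max' hne hi⟩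

theorem ncard_isAffNBC_eq_ncard_nbcVectors {n m : ℕ} (H : Fin m → Hyp n) :
    {S : Finset (Fin m) | IsAffNBC H S}.ncard =
      (nbcVectors univ fun i => (H i).affine).ncard := by
  have hinj : Function.Injective fun (S : Finset (Fin m)) (i : Fin m) => decide (i ∈ S) := by
    intro S T h
    ext i
    simpa using congrFun h i
  rw [← ncard_image_of_injective _ hinj]
  have key : ∀ S : Finset (Fin m), IsAffNBC H S ↔
      (fun i => decide (i ∈ S)) ∈ nbcVectors univ fun i => (H i).affine := by
    intro S
    rw [isAffNBC_iff]
    simp only [nbcVectors, mem_ofPred_eq, mem_univ, true_and, decide_eq_true_eq,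
      Hyp.affine_eq_zero_iff, ne_eq, mem_interA, Set.Nonempty, Finset.mem_filter, and_imp]
    simp only [imp.swap]
  congr 1
  ext σ
  constructor
  · rintro ⟨S, hS, rfl⟩
    exact (key S).1 hS
  · intro hσ
    have heq : (fun i => decide (i ∈ Finset.univ.filter fun i => σ i = true)) = σ := by
      ext i
      simp
    refine ⟨Finset.univ.filter fun i => σ i = true, (key _).2 ?_, heq⟩
    rwa [heq]

/-- **Theorem (Zaslavsky / Orlik–Terao).** The number of regions of a real hyperplane
arrangement (with hyperplanes listed in order `H 0 ≺ H 1 ≺ ⋯`) equals the number of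
its affine NBC subsets. -/
theorem stmt_1 (n m : ℕ) (H : Fin m → Hyp n)
    (hinj : Function.Injective fun i => (H i).carrier) :
    (regions H).ncard = {S : Finset (Fin m) | IsAffNBC H S}.ncard := by
  rw [ncard_regions_eq_ncard_signVectors, ncard_isAffNBC_eq_ncard_nbcVectors]
  exact ncard_signVectors_eq_ncard_nbcVectors (fun _ _ _ _ _ => mem_univ _) _
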